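/- Given an influence network G(W) on node set V, suppose the only nonempty maximal cohesive subset of G(W) is V itself. Then for every initial state x(0) ∈ ℝ^n: (a) there exists a finite update sequence along which the trajectory of the weighted-median opinion dynamics reaches a consensus vector; and (b) with respect to the i.i.d. uniform random update sequence, almost surely the trajectory x(t) reaches a consensus vector in finite time and remains there. -/

import Mathlib

open Finset MeasureTheory

/-- `m` is a weighted median of `x` associated with the weights `w`. -/
def IsWMedian {V : Type*} [Fintype V] (x w : V → ℝ) (m : ℝ) : Prop :=
  (∃ i, x i = m) ∧
    (∑ i ∈ Finset.univ.filter (fun i => x i < m), w i) ≤ 1 / 2 ∧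
    (∑ i ∈ Finset.univ.filter (fun i => m < x i), w i) ≤ 1 / 2

/-- `W` is a row-stochastic matrix. -/
def RowStochastic {V : Type*} [Fintype V] (W : V → V → ℝ) : Prop :=
  (∀ i j, 0 ≤ W i j) ∧ ∀ i, ∑ j, W i j = 1

open Classical in
/-- `Med W x i` : the weighted median of `x` w.r.t. the weights of row `i` of `W`;
if it is not unique, the weighted median closest to `x i`. -/
noncomputable def Med {V : Type*} [Fintype V] (W : V → V → ℝ) (x : V → ℝ) (i : V) : ℝ :=
  if h : ∃ m, IsWMedian x (W i) m ∧ ∀ m', IsWMedian x (W i) m' → |m - x i| ≤ |m' - x i| then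
    h.choose
  else x i

/-- Trajectory of the weighted-median opinion dynamics: at step `t → t+1` the node `u t`
updates its opinion to its weighted median, all other opinions stay unchanged. -/
noncomputable def traj {V : Type*} [Fintype V] [DecidableEq V]
    (W : V → V → ℝ) (u : ℕ → V) (x0 : V → ℝ) : ℕ → V → ℝ
  | 0 => x0
  | t + 1 => Function.update (traj W u x0 t) (u t) (Med W (traj W u x0 t) (u t))

def IsEquilibrium {V : Type*} [Fintype V] (W : V → V → ℝ) (x : V → ℝ) : Prop :=
  ∀ i, Med W x i = x i

/-- `M` is a cohesive set. -/
def Cohesive {V : Type*} [Fintype V] (W : V → V → ℝ) (M : Finset V) : Prop :=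
  ∀ i ∈ M, 1 / 2 ≤ ∑ j ∈ M, W i j

/-- `M` is a maximal cohesive set. -/
def MaxCohesive {V : Type*} [Fintype V] (W : V → V → ℝ) (M : Finset V) : Prop :=
  Cohesive W M ∧ ∀ i ∉ M, ¬ (1 / 2 < ∑ j ∈ M, W i j)

/-- One step of the cohesive-expansion process: add one node `i` outside the current
set whose total weight on the current set exceeds 1/2. -/
def ExpStep {V : Type*} [Fintype V] [DecidableEq V] (W : V → V → ℝ) (A B : Finset V) : Prop :=
  ∃ i ∉ A, 1 / 2 < ∑ j ∈ A, W i j ∧ B = insert i A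

/-- `E` is a cohesive expansion of `M`: obtained from `M` by repeatedly adding nodes,
until no further node can be added. -/
def IsExpansion {V : Type*} [Fintype V] [DecidableEq V] (W : V → V → ℝ) (M E : Finset V) : Prop :=
  Relation.ReflTransGen (ExpStep W) M E ∧ ∀ i ∉ E, ¬ (1 / 2 < ∑ j ∈ E, W i j)

/-- `(i,j)` is a decisive out-link of `i`. -/
def Decisive {V : Type*} [Fintype V] [DecidableEq V] (W : V → V → ℝ) (i j : V) : Prop :=
  ∃ θ : Finset V, (∀ k ∈ θ, W i k ≠ 0) ∧ j ∈ θ ∧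
    1 / 2 < ∑ k ∈ θ, W i k ∧ (∑ k ∈ θ.erase j, W i k) < 1 / 2

/-- `μ` is the law of the i.i.d. uniform random update sequence, characterized via its
finite-dimensional cylinder probabilities. -/
def IIDUniform {n : ℕ} (μ : Measure (ℕ → Fin n)) : Prop :=
  IsProbabilityMeasure μ ∧
    ∀ (s : Finset ℕ) (g : ℕ → Fin n),
      μ {u | ∀ t ∈ s, u t = g t} = (1 / (n : ENNReal)) ^ s.card

section Median

variable {V : Type*} [Fintype V]

theorem exists_isWMedian [Nonempty V] (x w : V → ℝ) (hsum : ∑ i, w i = 1) :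
    ∃ m, IsWMedian x w m := by
  classical
  obtain ⟨top, -, htop⟩ := Finset.exists_max_image (univ : Finset V) x univ_nonempty
  let good : Finset V := univ.filter fun i => ∑ j ∈ univ.filter (fun j => x i < x j), w j ≤ 1 / 2
  have hgood : good.Nonempty := by
    refine ⟨top, ?_⟩
    have hempty : univ.filter (fun j => x top < x j) = ∅ :=
      Finset.filter_eq_empty_iff.2 fun j _ => not_lt.2 (htop j (mem_univ j))
    simp [good, hempty]
  obtain ⟨i, hi, hmin⟩ := Finset.exists_min_image good x hgood
  refine ⟨x i, ⟨i, rfl⟩, ?_, (mem_filter.1 hi).2⟩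
  by_cases hne : (univ.filter fun j => x j < x i).Nonempty
  · obtain ⟨k, hk, hmax⟩ := Finset.exists_max_image _ x hne
    have hki : x k < x i := (mem_filter.1 hk).2
    have hbad : ¬ ∑ j ∈ univ.filter (fun j => x k < x j), w j ≤ 1 / 2 := fun h =>
      absurd (hmin k (mem_filter.2 ⟨mem_univ k, h⟩)) (not_le.2 hki)
    have heq : univ.filter (fun j => x k < x j) = univ.filter (fun j => ¬ x j < x i) := by
      ext j
      simp only [mem_filter, mem_univ, true_and]
      exact ⟨fun h h' => absurd (hmax j (by simpa using h')) (not_le.2 h),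
        fun h => hki.trans_le (not_lt.1 h)⟩
    rw [heq] at hbad
    have hsplit := Finset.sum_filter_add_sum_filter_not univ (fun j => x j < x i) w
    linarith
  · rw [not_nonempty_iff_eq_empty.1 hne]
    norm_num

theorem isWMedian_med {W : V → V → ℝ} (hW : RowStochastic W) (x : V → ℝ) (i : V) :
    IsWMedian x (W i) (Med W x i) := by
  classical
  have : Nonempty V := ⟨i⟩
  have hex : ∃ m, IsWMedian x (W i) m ∧
      ∀ m', IsWMedian x (W i) m' → |m - x i| ≤ |m' - x i| := by
    obtain ⟨m₀, hm₀⟩ := exists_isWMedian x (W i) (hW.2 i)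
    let medians : Finset ℝ := (univ.image x).filter (IsWMedian x (W i))
    have hmem : ∀ m, IsWMedian x (W i) m → m ∈ medians := fun m hm => by
      obtain ⟨j, hj⟩ := hm.1
      exact mem_filter.2 ⟨mem_image.2 ⟨j, mem_univ j, hj⟩, hm⟩
    obtain ⟨m, hm, hmin⟩ :=
      Finset.exists_min_image medians (fun m => |m - x i|) ⟨m₀, hmem m₀ hm₀⟩
    exact ⟨m, (mem_filter.1 hm).2, fun m' hm' => hmin m' (hmem m' hm')⟩
  rw [Med, dif_pos hex]
  exact hex.choose_spec.1

theorem le_med_of_half_lt {W : V → V → ℝ} (hW : RowStochastic W) {x : V → ℝ} {i : V} {c : ℝ}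
    (h : 1 / 2 < ∑ j ∈ univ.filter (fun j => c ≤ x j), W i j) : c ≤ Med W x i := by
  by_contra! hlt
  refine absurd (isWMedian_med hW x i).2.2 (not_le.2 (h.trans_le ?_))
  refine Finset.sum_le_sum_of_subset_of_nonneg (fun j hj => ?_) fun j _ _ => hW.1 i j
  simp only [mem_filter, mem_univ, true_and] at hj ⊢
  exact hlt.trans_le hj

theorem med_lt_of_half_lt {W : V → V → ℝ} (hW : RowStochastic W) {x : V → ℝ} {i : V} {c : ℝ}
    (h : 1 / 2 < ∑ j ∈ univ.filter (fun j => x j < c), W i j) : Med W x i < c := by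
  by_contra! hle
  refine absurd (isWMedian_med hW x i).2.1 (not_le.2 (h.trans_le ?_))
  refine Finset.sum_le_sum_of_subset_of_nonneg (fun j hj => ?_) fun j _ _ => hW.1 i j
  simp only [mem_filter, mem_univ, true_and] at hj ⊢
  exact hj.trans_le hle

end Median

section Trajectory

variable {V : Type*} [Fintype V] [DecidableEq V] {W : V → V → ℝ}

theorem traj_congr {u v : ℕ → V} (x : V → ℝ) {T : ℕ} (h : ∀ t < T, u t = v t) :
    traj W u x T = traj W v x T := by
  induction T with
  | zero => rfl
  | succ T ih => simp only [traj, ih fun t ht => h t (by omega), h T (by omega)]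

theorem traj_add (u : ℕ → V) (x : V → ℝ) (S T : ℕ) :
    traj W u x (S + T) = traj W (fun t => u (S + t)) (traj W u x S) T := by
  induction T with
  | zero => rfl
  | succ T ih => rw [← add_assoc]; simp only [traj, ih]

theorem traj_mem_range (hW : RowStochastic W) (u : ℕ → V) (x : V → ℝ) (t : ℕ) (i : V) :
    traj W u x t i ∈ Set.range x := by
  induction t generalizing i with
  | zero => exact ⟨i, rfl⟩
  | succ t ih =>
    by_cases hi : i = u t
    · subst hi
      obtain ⟨j, hj⟩ := (isWMedian_med hW (traj W u x t) (u t)).1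
      simpa [traj, ← hj] using ih j
    · simpa [traj, hi] using ih i

theorem traj_eq_self_of_consensus (hW : RowStochastic W) (u : ℕ → V) {x : V → ℝ}
    (hx : ∀ i j, x i = x j) (t : ℕ) : traj W u x t = x := by
  induction t with
  | zero => rfl
  | succ t ih =>
    obtain ⟨j, hj⟩ := (isWMedian_med hW x (u t)).1
    simp only [traj, ih, ← hj, hx j (u t), Function.update_eq_self]

/-- `y` is obtained from `x` by finitely many updates. -/
def Reachable (W : V → V → ℝ) (x y : V → ℝ) : Prop :=
  ∃ (T : ℕ) (u : ℕ → V), traj W u x T = y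

theorem exists_traj_concat (u v : ℕ → V) (S T : ℕ) :
    ∃ w : ℕ → V, ∀ x, traj W w x (S + T) = traj W v (traj W u x S) T := by
  refine ⟨fun t => if t < S then u t else v (t - S), fun x => ?_⟩
  rw [traj_add, traj_congr (v := u) x fun t ht => if_pos ht]
  exact traj_congr _ fun t _ => by simp

theorem Reachable.trans {x y z : V → ℝ} (hxy : Reachable W x y) (hyz : Reachable W y z) :
    Reachable W x z := by
  obtain ⟨S, u, rfl⟩ := hxy
  obtain ⟨T, v, rfl⟩ := hyz
  obtain ⟨w, hw⟩ := exists_traj_concat (W := W) u v S T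
  exact ⟨S + T, w, hw x⟩

theorem reachable_update (x : V → ℝ) (i : V) :
    Reachable W x (Function.update x i (Med W x i)) :=
  ⟨1, fun _ => i, rfl⟩

theorem Reachable.image_subset (hW : RowStochastic W) {x y : V → ℝ} (h : Reachable W x y) :
    univ.image y ⊆ univ.image x := by
  obtain ⟨T, u, rfl⟩ := h
  intro c hc
  obtain ⟨i, -, rfl⟩ := mem_image.1 hc
  simpa using traj_mem_range hW u x T i

theorem Cohesive.insert (hW : RowStochastic W) {M : Finset V} {i : V} (hM : Cohesive W M)
    (hi : 1 / 2 < ∑ j ∈ M, W i j) : Cohesive W (insert i M) := by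
  intro k hk
  have hle : ∑ j ∈ M, W k j ≤ ∑ j ∈ Insert.insert i M, W k j :=
    Finset.sum_le_sum_of_subset_of_nonneg (subset_insert i M) fun j _ _ => hW.1 k j
  rcases mem_insert.1 hk with rfl | hk
  · linarith
  · exact (hM k hk).trans hle

/-- If updating nodes with majority weight on the nodes satisfying `P` makes them satisfy `P`, the
set of nodes satisfying `P` can be expanded until no further node has majority weight on it. -/
theorem exists_reachable_expansion [Nonempty V] (hW : RowStochastic W)
    (P : ℝ → Prop) [DecidablePred P]
    (hP : ∀ x i, 1 / 2 < ∑ j ∈ univ.filter (fun j => P (x j)), W i j → P (Med W x i))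
    (x : V → ℝ) :
    ∃ y, Reachable W x y ∧ univ.filter (fun j => P (x j)) ⊆ univ.filter (fun j => P (y j)) ∧
      (Cohesive W (univ.filter fun j => P (x j)) → Cohesive W (univ.filter fun j => P (y j))) ∧
      ∀ i ∉ univ.filter (fun j => P (y j)),
        ¬ 1 / 2 < ∑ j ∈ univ.filter (fun j => P (y j)), W i j := by
  induction hk : (univ.filter fun j => ¬ P (x j)).card using Nat.strong_induction_on
    generalizing x with
  | _ k ih =>
    by_cases hclosed : ∀ i ∉ univ.filter (fun j => P (x j)),
        ¬ 1 / 2 < ∑ j ∈ univ.filter (fun j => P (x j)), W i j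
    · exact ⟨x, ⟨0, fun _ => Classical.arbitrary V, rfl⟩, Subset.rfl, id, hclosed⟩
    push Not at hclosed
    obtain ⟨i, hi, hmaj⟩ := hclosed
    have hPi := hP x i hmaj
    have hinsert : univ.filter (fun j => P (Function.update x i (Med W x i) j)) =
        Insert.insert i (univ.filter fun j => P (x j)) := by
      ext j
      by_cases hj : j = i
      · subst hj; simp [hPi]
      · simp [hj]
    have hcard : (univ.filter fun j => ¬ P (Function.update x i (Med W x i) j)).card < k := by
      rw [← hk, Finset.filter_not, Finset.filter_not, hinsert, ← compl_eq_univ_sdiff,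
        ← compl_eq_univ_sdiff]
      exact Finset.card_lt_card (Finset.compl_ssubset_compl.2 (Finset.ssubset_insert hi))
    obtain ⟨y, hxy, hsub, hcoh, hmax⟩ := ih _ hcard (Function.update x i (Med W x i)) rfl
    rw [hinsert] at hsub hcoh
    exact ⟨y, (reachable_update x i).trans hxy, (subset_insert i _).trans hsub,
      fun h => hcoh (h.insert hW hmaj), hmax⟩

theorem exists_reachable_consensus [Nonempty V] (hW : RowStochastic W)
    (honly : ∀ M : Finset V, M.Nonempty → MaxCohesive W M → M = univ) (x : V → ℝ) :
    ∃ y, Reachable W x y ∧ ∀ i j, y i = y j := by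
  induction hk : (univ.image x).card using Nat.strong_induction_on generalizing x with
  | _ k ih =>
    obtain ⟨top, -, htop⟩ := Finset.exists_max_image (univ : Finset V) x univ_nonempty
    obtain ⟨y, hxy, -, -, hymax⟩ := exists_reachable_expansion hW (fun r => x top ≤ r)
      (fun _ _ => le_med_of_half_lt hW) x
    by_cases hlow : (univ.filter fun j => y j < x top).Nonempty
    · obtain ⟨z, hyz, hsub, hcoh, hzmax⟩ := exists_reachable_expansion hW (fun r => r < x top)
        (fun _ _ => med_lt_of_half_lt hW) y
      have hylow : Cohesive W (univ.filter fun j => y j < x top) := by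
        intro i hi
        have hle := hymax i (by simpa using hi)
        have hsplit := Finset.sum_filter_add_sum_filter_not univ (fun j => x top ≤ y j) (W i)
        simp only [not_le] at hsplit
        have hsum := hW.2 i
        linarith
      have huniv := honly _ (hlow.mono hsub) ⟨hcoh hylow, hzmax⟩
      have hxz := hxy.trans hyz
      have hcard : (univ.image z).card < k := by
        rw [← hk]
        refine Finset.card_lt_card ((Finset.ssubset_iff_of_subset (hxz.image_subset hW)).2
          ⟨x top, mem_image_of_mem x (mem_univ top), fun hmem => ?_⟩)
        obtain ⟨j, -, hj⟩ := mem_image.1 hmem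
        exact (mem_filter.1 (huniv.symm ▸ mem_univ j)).2.ne hj
      obtain ⟨y', hzy', hcons⟩ := ih _ hcard z rfl
      exact ⟨y', hxz.trans hzy', hcons⟩
    · have heq : ∀ i, y i = x top := by
        intro i
        obtain ⟨j, -, hj⟩ := mem_image.1
          (hxy.image_subset hW (mem_image_of_mem y (mem_univ i)))
        refine le_antisymm (hj ▸ htop j (mem_univ j)) (not_lt.1 fun hlt => hlow ⟨i, ?_⟩)
        simpa using hlt
      exact ⟨y, hxy, fun i j => (heq i).trans (heq j).symm⟩

/-- A single update word leads every state of a finite set to consensus. -/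
theorem exists_synchronizing_word [Nonempty V] (hW : RowStochastic W)
    (honly : ∀ M : Finset V, M.Nonempty → MaxCohesive W M → M = univ)
    {X : Set (V → ℝ)} (hX : X.Finite) :
    ∃ (T : ℕ) (u : ℕ → V), ∀ x ∈ X, ∀ i j, traj W u x T i = traj W u x T j := by
  induction X, hX using Set.Finite.induction_on with
  | empty => exact ⟨0, fun _ => Classical.arbitrary V, by simp⟩
  | @insert x X _ _ ih =>
    obtain ⟨S, u, hu⟩ := ih
    obtain ⟨_, ⟨T, v, rfl⟩, hv⟩ := exists_reachable_consensus hW honly (traj W u x S)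
    obtain ⟨w, hw⟩ := exists_traj_concat (W := W) u v S T
    refine ⟨S + T, w, ?_⟩
    rintro y (rfl | hy)
    · simpa only [hw] using hv
    · simpa only [hw, traj_eq_self_of_consensus hW v (hu y hy)] using hu y hy

end Trajectory

/-- Under the i.i.d. uniform law, every finite word almost surely occurs as an aligned block. -/
theorem IIDUniform.measure_exists_block {n : ℕ} {μ : Measure (ℕ → Fin n)}
    (hμ : IIDUniform μ) {L : ℕ} (hL : 0 < L) (g : ℕ → Fin n) :
    μ {u | ∃ k, ∀ t < L, u (k * L + t) = g t} = 1 := by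
  classical
  have := hμ.1
  let block : ℕ → Set (ℕ → Fin n) := fun k => {u | ∀ t < L, u (k * L + t) = g t}
  have hinter : ∀ s : Finset ℕ,
      μ (⋂ k ∈ s, block k) = ((1 / (n : ENNReal)) ^ L) ^ s.card := by
    intro s
    let times : Finset ℕ := (s ×ˢ range L).image fun p => p.1 * L + p.2
    have hset : (⋂ k ∈ s, block k) = {u | ∀ t ∈ times, u t = g (t % L)} := by
      ext u
      simp only [block, Set.mem_iInter, Set.mem_ofPred_eq, times, mem_image, mem_product,
        mem_range, Prod.exists]
      constructor
      · rintro h _ ⟨k, t, ⟨hk, ht⟩, rfl⟩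
        rw [h k hk t ht, Nat.mul_add_mod_of_lt ht]
      · intro h k hk t ht
        rw [h _ ⟨k, t, ⟨hk, ht⟩, rfl⟩, Nat.mul_add_mod_of_lt ht]
    have hcard : times.card = L * s.card := by
      rw [Finset.card_image_of_injOn, card_product, card_range, mul_comm]
      rintro ⟨k, t⟩ hp ⟨k', t'⟩ hp' heq
      simp only [coe_product, Set.mem_prod, mem_coe, mem_range] at hp hp' heq
      have hmod := congrArg (· % L) heq
      simp only [Nat.mul_add_mod_of_lt hp.2, Nat.mul_add_mod_of_lt hp'.2] at hmod
      subst hmod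
      simpa [hL.ne'] using heq
    rw [hset, hμ.2, hcard, pow_mul]
  have hblock : ∀ k, μ (block k) = (1 / (n : ENNReal)) ^ L := fun k => by
    simpa using hinter {k}
  have hmeas : ∀ k, MeasurableSet (block k) := fun k => by
    have : block k = ⋂ t ∈ range L, {u | u (k * L + t) = g t} := by
      ext u; simp [block]
    rw [this]
    exact Finset.measurableSet_biInter _ fun t _ =>
      measurableSet_eq_fun (measurable_pi_apply (k * L + t)) measurable_const
  have hindep : ProbabilityTheory.iIndepSet block μ :=
    (ProbabilityTheory.iIndepSet_iff_meas_biInter hmeas).2 fun s => by simp [hinter, hblock]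
  have hdiv : ∑' k, μ (block k) = ⊤ := by
    simp only [hblock]
    exact ENNReal.tsum_const_eq_top_of_ne_zero (by simp)
  refine le_antisymm prob_le_one ?_
  rw [← ProbabilityTheory.measure_limsup_eq_one hmeas hindep hdiv]
  refine measure_mono fun u hu => ?_
  exact (Filter.mem_limsup_iff_frequently_mem.1 hu).exists

/-- if the only nonempty maximal cohesive set is `V` itself, then from any
initial state (a) some finite update sequence reaches consensus, and (b) under the i.i.d.
uniform random update sequence the dynamics almost surely reach consensus in finite time
and remain there. -/
theorem consensus_when_only_max_cohesive_is_univ (n : ℕ) (hn : 0 < n)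
    (W : Fin n → Fin n → ℝ) (hW : RowStochastic W)
    (honly : ∀ M : Finset (Fin n), M.Nonempty → MaxCohesive W M → M = Finset.univ)
    (x0 : Fin n → ℝ) :
    (∃ (T : ℕ) (u : ℕ → Fin n), ∀ i j, traj W u x0 T i = traj W u x0 T j) ∧
    ∀ μ : Measure (ℕ → Fin n), IIDUniform μ →
      μ {u | ∃ T : ℕ, (∀ i j, traj W u x0 T i = traj W u x0 T j) ∧
          ∀ t, T ≤ t → traj W u x0 t = traj W u x0 T} = 1 := by
  have : Nonempty (Fin n) := ⟨⟨0, hn⟩⟩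
  refine ⟨?_, fun μ hμ => ?_⟩
  · obtain ⟨_, ⟨T, u, rfl⟩, hcons⟩ := exists_reachable_consensus hW honly x0
    exact ⟨T, u, hcons⟩
  have := hμ.1
  have hfinite : {y : Fin n → ℝ | ∀ i, y i ∈ Set.range x0}.Finite :=
    Set.Finite.pi' fun _ => Set.finite_range x0
  obtain ⟨T, g, hsync⟩ := exists_synchronizing_word hW honly hfinite
  refine le_antisymm prob_le_one ?_
  rw [← hμ.measure_exists_block T.succ_pos g]
  refine measure_mono ?_
  rintro u ⟨k, hk⟩
  have hcons : ∀ i j, traj W u x0 (k * (T + 1) + T) i = traj W u x0 (k * (T + 1) + T) j := by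
    rw [traj_add, traj_congr (v := g) _ fun t ht => hk t (by omega)]
    exact hsync _ (traj_mem_range hW u x0 _)
  refine ⟨k * (T + 1) + T, hcons, fun t ht => ?_⟩
  obtain ⟨s, rfl⟩ := Nat.exists_eq_add_of_le ht
  rw [traj_add, traj_eq_self_of_consensus hW _ hcons]
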